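/- arXiv:2208.13409 — 6 statements merged into one kernel-verified Lean document; each statement's English description precedes it below -/
import Mathlib

section
/- In the single-node displacement test with initial density 1 in the central cell [0,Δx]² and 0 elsewhere, the exact mass transported through the top-right corner into the diagonal neighbour cell [Δx,2Δx]² is computed as follows: the intersection of the Lagrangian quadrilateral with vertices (0,0), (Δx,0), ((1+ε)Δx,(1+ε)Δx), (0,Δx) with the square [Δx,2Δx]² has area ε²Δx²/(1+ε); multiplying by the Lagrangian density 1/(1+ε), the transported mass fraction equals ε²/(1+ε)², which satisfies ε²/(1+ε)² = ε² − 2ε³ + O(ε⁴) as ε → 0⁺. -/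
open MeasureTheory Filter Asymptotics Topology

/-- The region between the graphs of `f` and `g` over `s`, graphs included, has as its area the
integral of `g - f`. -/
theorem volume_region_between_cc {f g : ℝ → ℝ} {s : Set ℝ} (hs : MeasurableSet s)
    (hf : Measurable f) (hg : Measurable g) (hint : IntegrableOn (fun x => g x - f x) s)
    (hfg : ∀ x ∈ s, f x ≤ g x) :
    volume {p : ℝ × ℝ | p.1 ∈ s ∧ p.2 ∈ Set.Icc (f p.1) (g p.1)} =
      ENNReal.ofReal (∫ x in s, (g x - f x)) := by
  rw [Measure.volume_eq_prod, Measure.prod_apply (measurableSet_region_between_cc hf hg hs),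
    ofReal_integral_eq_lintegral_ofReal hint
      ((ae_restrict_iff' hs).2 (ae_of_all _ fun x hx => sub_nonneg.2 (hfg x hx))),
    ← lintegral_indicator hs]
  refine lintegral_congr fun x => ?_
  by_cases hx : x ∈ s
  · have : Prod.mk x ⁻¹' {p : ℝ × ℝ | p.1 ∈ s ∧ p.2 ∈ Set.Icc (f p.1) (g p.1)} =
        Set.Icc (f x) (g x) := by
      ext y
      simp [hx]
    rw [this, Real.volume_Icc, Set.indicator_of_mem hx]
  · simp [hx]

/-- The part of the Lagrangian quadrilateral beyond the corner `(h, h)` is cut out by its two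
edges through the displaced node. -/
theorem mem_convexHull_displaced_cell_iff {h ε x y : ℝ} (hh : 0 < h) (hε : 0 < ε)
    (hx : h ≤ x) (hy : h ≤ y) :
    (x, y) ∈ convexHull ℝ
        ({((0 : ℝ), (0 : ℝ)), (h, 0), ((1 + ε) * h, (1 + ε) * h), (0, h)} : Set (ℝ × ℝ)) ↔
      (1 + ε) * (x - h) ≤ ε * y ∧ (1 + ε) * (y - h) ≤ ε * x := by
  constructor
  · intro hmem
    let S : Set (ℝ × ℝ) :=
      {p | (1 + ε) * (p.1 - h) ≤ ε * p.2 ∧ (1 + ε) * (p.2 - h) ≤ ε * p.1}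
    have hS : Convex ℝ S := by
      rintro ⟨x₁, y₁⟩ ⟨h₁, h₁'⟩ ⟨x₂, y₂⟩ ⟨h₂, h₂'⟩ a b ha hb hab
      obtain rfl : b = 1 - a := by linarith
      simp only [S, Set.mem_ofPred_eq, Prod.fst_add, Prod.snd_add, Prod.smul_fst, Prod.smul_snd,
        smul_eq_mul] at *
      constructor
      · linear_combination a * h₁ + (1 - a) * h₂
      · linear_combination a * h₁' + (1 - a) * h₂'
    refine convexHull_min (t := S) ?_ hS hmem
    have : 0 < ε * h := mul_pos hε hh
    rintro p (rfl | rfl | rfl | rfl) <;> constructor <;> dsimp only <;> nlinarith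
  · rintro ⟨h₁, h₂⟩
    have hd : 0 < (1 + 2 * ε) * h := by positivity
    let w : Fin 3 → ℝ := ![(ε * x - (1 + ε) * (y - h)) / ((1 + 2 * ε) * h),
      (ε * y - (1 + ε) * (x - h)) / ((1 + 2 * ε) * h), (x + y - h) / ((1 + 2 * ε) * h)]
    let z : Fin 3 → ℝ × ℝ := ![(h, 0), (0, h), ((1 + ε) * h, (1 + ε) * h)]
    have hsum : ∑ i, w i • z i = (x, y) := by
      simp only [Fin.sum_univ_three, w, z]
      ext
      · simp
        field_simp
        ring
      · simp
        field_simp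
        ring
    rw [← hsum]
    refine (convex_convexHull ℝ _).sum_mem (fun i _ => ?_) ?_ (fun i _ => ?_)
    · fin_cases i <;> refine div_nonneg ?_ hd.le <;> linarith
    · simp only [Fin.sum_univ_three, w]
      simp
      field_simp
      ring
    · apply subset_convexHull
      fin_cases i <;> simp [z]

/-- The part of the Lagrangian quadrilateral in the diagonal neighbour cell, described as the
region between two graphs. -/
theorem displaced_cell_inter_diagonal_cell {h ε : ℝ} (hh : 0 < h) (hε : ε ∈ Set.Ioo (0 : ℝ) 1) :
    convexHull ℝ
        ({((0 : ℝ), (0 : ℝ)), (h, 0), ((1 + ε) * h, (1 + ε) * h), (0, h)} : Set (ℝ × ℝ))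
        ∩ (Set.Icc h (2 * h) ×ˢ Set.Icc h (2 * h)) =
      {p : ℝ × ℝ | p.1 ∈ Set.Icc h ((1 + ε) * h) ∧
        p.2 ∈ Set.Icc (max h ((1 + ε) * (p.1 - h) / ε)) (h + ε * p.1 / (1 + ε))} := by
  obtain ⟨hε₀, hε₁⟩ := hε
  have hε' : 0 < 1 + ε := by linarith
  ext ⟨x, y⟩
  have lower : (1 + ε) * (x - h) / ε ≤ y ↔ (1 + ε) * (x - h) ≤ ε * y := by
    rw [div_le_iff₀ hε₀, mul_comm y]
  have upper : y ≤ h + ε * x / (1 + ε) ↔ (1 + ε) * (y - h) ≤ ε * x := by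
    rw [← sub_le_iff_le_add', le_div_iff₀ hε', mul_comm (y - h)]
  simp only [Set.mem_inter_iff, Set.mem_prod, Set.mem_Icc, Set.mem_ofPred_eq, max_le_iff, lower,
    upper]
  constructor
  · rintro ⟨hmem, ⟨hx, -⟩, hy, -⟩
    obtain ⟨h₁, h₂⟩ := (mem_convexHull_displaced_cell_iff hh hε₀ hx hy).1 hmem
    refine ⟨⟨hx, ?_⟩, ⟨hy, h₁⟩, h₂⟩
    refine le_of_mul_le_mul_left ?_ (show 0 < 1 + 2 * ε by linarith)
    linear_combination (1 + ε) * h₁ + ε * h₂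
  · rintro ⟨⟨hx, hx'⟩, ⟨hy, h₁⟩, h₂⟩
    have hεh : ε * h ≤ h := by nlinarith
    refine ⟨(mem_convexHull_displaced_cell_iff hh hε₀ hx hy).2 ⟨h₁, h₂⟩, ⟨hx, by linarith⟩,
      hy, ?_⟩
    refine le_of_mul_le_mul_left ?_ hε'
    linear_combination h₂ + ε * hx' + (1 + ε) * hεh

theorem integral_displaced_cell_height {h ε : ℝ} (hh : 0 < h) (hε : 0 < ε) :
    ∫ x in h..(1 + ε) * h, ((h + ε * x / (1 + ε)) - max h ((1 + ε) * (x - h) / ε)) =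
      ε ^ 2 * h ^ 2 / (1 + ε) := by
  have hε' : 0 < 1 + ε := by linarith
  have hmid : h ≤ h + ε * h / (1 + ε) := le_add_of_nonneg_right (by positivity)
  have hmid' : h + ε * h / (1 + ε) ≤ (1 + ε) * h := by
    have : ε * h / (1 + ε) ≤ ε * h := div_le_self (by positivity) (by linarith)
    linarith
  have key : ∀ x, (1 + ε) * (x - h) / ε ≤ h ↔ x ≤ h + ε * h / (1 + ε) := fun x => by
    rw [div_le_iff₀ hε, ← sub_le_iff_le_add', le_div_iff₀ hε', mul_comm (x - h), mul_comm h ε]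
  have hcont : Continuous fun x : ℝ =>
      (h + ε * x / (1 + ε)) - max h ((1 + ε) * (x - h) / ε) := by fun_prop
  have left : ∫ x in h..h + ε * h / (1 + ε),
      ((h + ε * x / (1 + ε)) - max h ((1 + ε) * (x - h) / ε)) =
      ∫ x in h..h + ε * h / (1 + ε), ε / (1 + ε) * x := by
    refine intervalIntegral.integral_congr fun x hx => ?_
    rw [Set.uIcc_of_le hmid] at hx
    rw [max_eq_left ((key x).2 hx.2)]
    ring
  have right : ∫ x in h + ε * h / (1 + ε)..(1 + ε) * h,
      ((h + ε * x / (1 + ε)) - max h ((1 + ε) * (x - h) / ε)) =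
      ∫ x in h + ε * h / (1 + ε)..(1 + ε) * h,
        ((h + (1 + ε) * h / ε) + (ε / (1 + ε) - (1 + ε) / ε) * x) := by
    refine intervalIntegral.integral_congr fun x hx => ?_
    rw [Set.uIcc_of_le hmid'] at hx
    have hx' : h ≤ (1 + ε) * (x - h) / ε := by
      rw [le_div_iff₀ hε]
      have := hx.1
      rw [← le_sub_iff_add_le', div_le_iff₀ hε'] at this
      linarith
    rw [max_eq_right hx']
    ring
  rw [← intervalIntegral.integral_add_adjacent_intervals (hcont.intervalIntegrable _ _)
    (hcont.intervalIntegrable _ _), left, right, intervalIntegral.integral_add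
    (by simp) (Continuous.intervalIntegrable (by fun_prop) _ _),
    intervalIntegral.integral_const_mul, intervalIntegral.integral_const_mul,
    intervalIntegral.integral_const, integral_id, integral_id, smul_eq_mul]
  field_simp
  ring

theorem corner_flux_sub_isBigO :
    (fun ε : ℝ => ε ^ 2 / (1 + ε) ^ 2 - (ε ^ 2 - 2 * ε ^ 3)) =O[𝓝[>] 0]
      (fun ε : ℝ => ε ^ 4) := by
  refine IsBigO.of_bound 3 ?_
  filter_upwards [self_mem_nhdsWithin] with ε hε
  have hε : 0 < ε := hε
  have : ε ^ 2 / (1 + ε) ^ 2 - (ε ^ 2 - 2 * ε ^ 3) = (3 + 2 * ε) / (1 + ε) ^ 2 * ε ^ 4 := by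
    field_simp
    ring
  rw [this, norm_mul]
  gcongr
  rw [Real.norm_of_nonneg (by positivity), div_le_iff₀ (by positivity)]
  nlinarith

/-- Exact corner mass flux in the single-node displacement test: the
intersection of the Lagrangian quadrilateral with the diagonal neighbour cell
`[Δx,2Δx]²` has area `ε²Δx²/(1+ε)`; multiplying by the Lagrangian density
`1/(1+ε)`, the transported mass fraction is `ε²/(1+ε)² = ε² − 2ε³ + O(ε⁴)`. -/
theorem exact_corner_mass_flux_single_node_displacement
    (Δx ε : ℝ) (hΔx : 0 < Δx) (hε : ε ∈ Set.Ioo (0 : ℝ) 1) :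
    volume ((convexHull ℝ
        ({((0 : ℝ), (0 : ℝ)), (Δx, 0), ((1 + ε) * Δx, (1 + ε) * Δx), (0, Δx)} :
          Set (ℝ × ℝ)))
        ∩ (Set.Icc Δx (2 * Δx) ×ˢ Set.Icc Δx (2 * Δx)))
      = ENNReal.ofReal (ε ^ 2 * Δx ^ 2 / (1 + ε)) ∧
    (ε ^ 2 * Δx ^ 2 / (1 + ε)) * (1 / (1 + ε)) / Δx ^ 2 = ε ^ 2 / (1 + ε) ^ 2 ∧
    (fun ε : ℝ => ε ^ 2 / (1 + ε) ^ 2 - (ε ^ 2 - 2 * ε ^ 3)) =O[𝓝[>] 0]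
      (fun ε : ℝ => ε ^ 4) := by
  obtain ⟨hε₀, hε₁⟩ := id hε
  have hε' : 0 < 1 + ε := by linarith
  refine ⟨?_, by field_simp, corner_flux_sub_isBigO⟩
  rw [displaced_cell_inter_diagonal_cell hΔx hε,
    volume_region_between_cc (f := fun x => max Δx ((1 + ε) * (x - Δx) / ε))
      (g := fun x => Δx + ε * x / (1 + ε)) measurableSet_Icc (by fun_prop) (by fun_prop)
      (Continuous.integrableOn_Icc (by fun_prop)), integral_Icc_eq_integral_Ioc,
    ← intervalIntegral.integral_of_le (by nlinarith), integral_displaced_cell_height hΔx hε₀]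
  rintro x ⟨hx, hx'⟩
  have : 0 ≤ x := hΔx.le.trans hx
  refine max_le (le_add_of_nonneg_right (by positivity)) ?_
  rw [← sub_nonneg]
  have : Δx + ε * x / (1 + ε) - (1 + ε) * (x - Δx) / ε =
      (1 + 2 * ε) * ((1 + ε) * Δx - x) / (ε * (1 + ε)) := by
    field_simp
    ring
  rw [this]
  exact div_nonneg (mul_nonneg (by linarith) (by linarith)) (by positivity)
end

section
/- In the single-node displacement test with initial density 1 in the central cell and 0 elsewhere, the corner mass flux of the Direct remap with Corner Fluxes equals ρ^{lagCF}·dVol_p = ε² / (1 + ε/(1+ε) + ε²) (in units of the initial cell mass), and as ε → 0⁺ this satisfies ε²/(1 + ε/(1+ε) + ε²) = ε² − ε³ + O(ε⁴); thus the DirectCF corner mass flux agrees with the exact value ε² − 2ε³ + O(ε⁴) at the leading (second) order, whereas the Direct remap (without corner fluxes) gives a corner mass flux identically 0. -/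
open Filter Asymptotics Topology

/-- The DirectCF corner mass flux in the single-node displacement test equals
`ρ^{lagCF}·dVol_p = ε²/(1 + ε/(1+ε) + ε²)` (in units of the initial cell mass),
which is `ε² − ε³ + O(ε⁴)` as `ε → 0⁺`, hence agrees with the exact value
`ε²/(1+ε)² = ε² − 2ε³ + O(ε⁴)` at the leading (second) order; the Direct remap
(corner flux identically `0`) does not. -/
theorem directCF_corner_mass_flux_single_node_displacement :
    (∀ ε : ℝ, ε ∈ Set.Ioo (0 : ℝ) 1 → ∀ Δx : ℝ, 0 < Δx →
      (1 / (1 + ε / (1 + ε) + ε ^ 2)) * (ε * Δx) ^ 2 / Δx ^ 2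
        = ε ^ 2 / (1 + ε / (1 + ε) + ε ^ 2)) ∧
    (fun ε : ℝ => ε ^ 2 / (1 + ε / (1 + ε) + ε ^ 2) - (ε ^ 2 - ε ^ 3)) =O[𝓝[>] 0]
      (fun ε : ℝ => ε ^ 4) ∧
    (fun ε : ℝ => ε ^ 2 / (1 + ε / (1 + ε) + ε ^ 2) - ε ^ 2 / (1 + ε) ^ 2)
      =o[𝓝[>] 0] (fun ε : ℝ => ε ^ 2) ∧
    ¬ ((fun ε : ℝ => (0 : ℝ) - ε ^ 2 / (1 + ε) ^ 2) =o[𝓝[>] 0]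
        (fun ε : ℝ => ε ^ 2)) := by
  have tendsto_of_continuousAt {h : ℝ → ℝ} (hc : ContinuousAt h 0) :
      Tendsto h (𝓝[>] 0) (𝓝 (h 0)) := hc.tendsto.mono_left nhdsWithin_le_nhds
  refine ⟨fun ε _ Δx hΔx => ?_, ?_, ?_, fun hlo => ?_⟩
  · rw [mul_pow, ← mul_assoc, mul_div_cancel_right₀ _ (pow_ne_zero 2 hΔx.ne'),
      one_div_mul_eq_div]
  · refine IsBigO.of_bound 1 ?_
    filter_upwards [self_mem_nhdsWithin] with ε hε
    have hpos : 0 < ε := hε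
    have key : ε ^ 2 / (1 + ε / (1 + ε) + ε ^ 2) - (ε ^ 2 - ε ^ 3) =
        ε ^ 4 * ((1 + ε ^ 2) / (1 + 2 * ε + ε ^ 2 + ε ^ 3)) := by
      have h_den : 1 + ε / (1 + ε) + ε ^ 2 = (1 + 2 * ε + ε ^ 2 + ε ^ 3) / (1 + ε) := by
        field_simp
        ring
      rw [h_den]
      field_simp
      ring
    have h_le : (1 + ε ^ 2) / (1 + 2 * ε + ε ^ 2 + ε ^ 3) ≤ 1 := by
      rw [div_le_one (by positivity)]
      have := pow_pos hpos 3
      linarith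
    rw [key, norm_mul, mul_comm]
    gcongr
    rwa [Real.norm_of_nonneg (by positivity)]
  · have hc : ContinuousAt
        (fun ε : ℝ => 1 / (1 + ε / (1 + ε) + ε ^ 2) - 1 / (1 + ε) ^ 2) 0 := by
      fun_prop (disch := norm_num)
    have ht := tendsto_of_continuousAt hc
    norm_num at ht
    have hlo := (isBigO_refl (fun ε : ℝ => ε ^ 2) (𝓝[>] 0)).mul_isLittleO
      ((isLittleO_one_iff ℝ).2 ht)
    refine hlo.congr (fun ε => ?_) fun ε => mul_one _
    ring
  · have hc : ContinuousAt (fun ε : ℝ => -1 / (1 + ε) ^ 2) 0 := by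
      fun_prop (disch := norm_num)
    have ht := tendsto_of_continuousAt hc
    have h_zero : Tendsto (fun ε : ℝ => -1 / (1 + ε) ^ 2) (𝓝[>] 0) (𝓝 0) := by
      refine hlo.tendsto_div_nhds_zero.congr' ?_
      filter_upwards [self_mem_nhdsWithin] with ε hε
      have hpos : 0 < ε := hε
      field_simp
      ring
    have := tendsto_nhds_unique ht h_zero
    norm_num at this
end

section
/- The point-vortex velocity field together with the density ρ(x,y) = ρ₀ · exp(−K₀/(x²+y²)) is a stationary solution of the compressible Euler momentum equation with perfect-gas pressure. Precisely: let γ > 1, e₀ > 0, ρ₀ > 0 and σ₀ ∈ ℝ, set K₀ = σ₀²/(8π²(γ−1)e₀), let u(x,y) = σ₀/(2π(x²+y²)) · (−y, x), ρ(x,y) = ρ₀ exp(−K₀/(x²+y²)) and P(x,y) = (γ−1)e₀·ρ(x,y). Then at every point (x,y) ≠ (0,0): u₁ ∂u/∂x + u₂ ∂u/∂y = −(1/ρ)·∇P, i.e., the convective acceleration (u·∇)u equals −∇P/ρ (both sides equal −σ₀²/(4π²(x²+y²)²)·(x,y)). -/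
theorem hasDerivAt_div_sq_add {a b : ℝ} (c : ℝ) (h : a ^ 2 + b ≠ 0) :
    HasDerivAt (fun t : ℝ => c / (t ^ 2 + b)) (-(2 * c * a) / (a ^ 2 + b) ^ 2) a := by
  have hd : HasDerivAt (fun t : ℝ => t ^ 2 + b) (2 * a) a := by
    simpa using (hasDerivAt_pow 2 a).add_const b
  exact ((hasDerivAt_const a c).fun_div hd h).congr_deriv (by ring)

theorem hasDerivAt_mul_exp_div_sq_add {a b : ℝ} (A c : ℝ) (h : a ^ 2 + b ≠ 0) :
    HasDerivAt (fun t : ℝ => A * Real.exp (c / (t ^ 2 + b)))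
      (A * (Real.exp (c / (a ^ 2 + b)) * (-(2 * c * a) / (a ^ 2 + b) ^ 2))) a :=
  (hasDerivAt_div_sq_add c h).exp.const_mul A

/-- The point vortex with density `ρ = ρ₀ exp(−K₀/(x²+y²))` and perfect-gas
pressure `P = (γ−1)e₀ρ` is a stationary solution of the Euler momentum
equation: `(u·∇)u = −∇P/ρ`, both sides equal to
`−σ₀²/(4π²(x²+y²)²)·(x,y)`, at every point away from the origin. -/
theorem point_vortex_stationary_euler
    (γ e₀ ρ₀ σ₀ K₀ : ℝ) (hγ : 1 < γ) (he₀ : 0 < e₀) (hρ₀ : 0 < ρ₀)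
    (hK : K₀ = σ₀ ^ 2 / (8 * Real.pi ^ 2 * (γ - 1) * e₀))
    (u1 u2 ρ P : ℝ → ℝ → ℝ)
    (hu1 : ∀ x y, u1 x y = σ₀ / (2 * Real.pi * (x ^ 2 + y ^ 2)) * (-y))
    (hu2 : ∀ x y, u2 x y = σ₀ / (2 * Real.pi * (x ^ 2 + y ^ 2)) * x)
    (hρ : ∀ x y, ρ x y = ρ₀ * Real.exp (-K₀ / (x ^ 2 + y ^ 2)))
    (hP : ∀ x y, P x y = (γ - 1) * e₀ * ρ x y) :
    ∀ x y : ℝ, (x, y) ≠ ((0 : ℝ), (0 : ℝ)) →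
      (u1 x y * deriv (fun x' => u1 x' y) x
          + u2 x y * deriv (fun y' => u1 x y') y
        = -(1 / ρ x y) * deriv (fun x' => P x' y) x) ∧
      (u1 x y * deriv (fun x' => u2 x' y) x
          + u2 x y * deriv (fun y' => u2 x y') y
        = -(1 / ρ x y) * deriv (fun y' => P x y') y) ∧
      (u1 x y * deriv (fun x' => u1 x' y) x
          + u2 x y * deriv (fun y' => u1 x y') y
        = -(σ₀ ^ 2 / (4 * Real.pi ^ 2 * (x ^ 2 + y ^ 2) ^ 2)) * x) ∧
      (u1 x y * deriv (fun x' => u2 x' y) x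
          + u2 x y * deriv (fun y' => u2 x y') y
        = -(σ₀ ^ 2 / (4 * Real.pi ^ 2 * (x ^ 2 + y ^ 2) ^ 2)) * y) := by
  intro x y hxy
  have hr : x ^ 2 + y ^ 2 ≠ 0 := by
    intro h
    apply hxy
    have hx : x = 0 := by nlinarith [sq_nonneg x, sq_nonneg y]
    have hy : y = 0 := by nlinarith [sq_nonneg x, sq_nonneg y]
    rw [hx, hy]
  have hr' : y ^ 2 + x ^ 2 ≠ 0 := by rwa [add_comm]
  have hπ : Real.pi ≠ 0 := Real.pi_ne_zero
  have hγ' : γ - 1 ≠ 0 := (sub_pos.mpr hγ).ne'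
  have he : e₀ ≠ 0 := he₀.ne'
  have hρ' : ρ₀ ≠ 0 := hρ₀.ne'
  have hσ (s : ℝ) : σ₀ / (2 * Real.pi * s) = σ₀ / (2 * Real.pi) / s := (div_div _ _ _).symm
  have d1x : deriv (fun x' => u1 x' y) x =
      -(2 * (σ₀ / (2 * Real.pi)) * x) / (x ^ 2 + y ^ 2) ^ 2 * -y := by
    simp only [hu1, hσ]
    exact ((hasDerivAt_div_sq_add _ hr).mul_const _).deriv
  have d2y : deriv (fun y' => u2 x y') y =
      -(2 * (σ₀ / (2 * Real.pi)) * y) / (x ^ 2 + y ^ 2) ^ 2 * x := by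
    simp only [hu2, hσ, add_comm (x ^ 2)]
    exact ((hasDerivAt_div_sq_add _ hr').mul_const _).deriv
  have d1y : deriv (fun y' => u1 x y') y =
      -(2 * (σ₀ / (2 * Real.pi)) * y) / (x ^ 2 + y ^ 2) ^ 2 * -y
        + σ₀ / (2 * Real.pi) / (x ^ 2 + y ^ 2) * -1 := by
    simp only [hu1, hσ, add_comm (x ^ 2)]
    exact ((hasDerivAt_div_sq_add _ hr').fun_mul (hasDerivAt_id' y).fun_neg).deriv
  have d2x : deriv (fun x' => u2 x' y) x =
      -(2 * (σ₀ / (2 * Real.pi)) * x) / (x ^ 2 + y ^ 2) ^ 2 * x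
        + σ₀ / (2 * Real.pi) / (x ^ 2 + y ^ 2) * 1 := by
    simp only [hu2, hσ]
    exact ((hasDerivAt_div_sq_add _ hr).fun_mul (hasDerivAt_id' x)).deriv
  have dPx : deriv (fun x' => P x' y) x =
      (γ - 1) * e₀ * (ρ x y * (-(2 * -K₀ * x) / (x ^ 2 + y ^ 2) ^ 2)) := by
    simp only [hP, hρ]
    rw [((hasDerivAt_mul_exp_div_sq_add ρ₀ (-K₀) hr).const_mul _).deriv]
    ring
  have dPy : deriv (fun y' => P x y') y =
      (γ - 1) * e₀ * (ρ x y * (-(2 * -K₀ * y) / (x ^ 2 + y ^ 2) ^ 2)) := by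
    simp only [hP, hρ, add_comm (x ^ 2)]
    rw [((hasDerivAt_mul_exp_div_sq_add ρ₀ (-K₀) hr').const_mul _).deriv]
    ring
  have hρxy : ρ x y ≠ 0 := by
    rw [hρ]
    exact mul_ne_zero hρ' (Real.exp_ne_zero _)
  have accel_x : u1 x y * deriv (fun x' => u1 x' y) x + u2 x y * deriv (fun y' => u1 x y') y
      = -(σ₀ ^ 2 / (4 * Real.pi ^ 2 * (x ^ 2 + y ^ 2) ^ 2)) * x := by
    rw [d1x, d1y, hu1, hu2]
    field_simp
    ring
  have accel_y : u1 x y * deriv (fun x' => u2 x' y) x + u2 x y * deriv (fun y' => u2 x y') y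
      = -(σ₀ ^ 2 / (4 * Real.pi ^ 2 * (x ^ 2 + y ^ 2) ^ 2)) * y := by
    rw [d2x, d2y, hu1, hu2]
    field_simp
    ring
  refine ⟨?_, ?_, accel_x, accel_y⟩
  · rw [accel_x, dPx, hK]
    field_simp
    ring
  · rw [accel_y, dPy, hK]
    field_simp
    ring
end

section
/- Staggered (node-based) discrete rotational of the point vortex field on the central cell: let Δx > 0, σ₀ ∈ ℝ, α₀ = σ₀/(2πΔx²), and let u(x,y) = σ₀/(2π(x²+y²))·(−y,x) be the point-vortex field. Let p₁ = (Δx/2, Δx/2), p₂ = (−Δx/2, Δx/2), p₃ = (−Δx/2, −Δx/2), p₄ = (Δx/2, −Δx/2) be the four nodes of the square cell centred at the origin, in counterclockwise order (indices mod 4), and let T_k be the unit tangent vector of the edge from p_k to p_{k+1} (i.e., T_k = (p_{k+1} − p_k)/Δx). Then the trapezoidal discrete rotational rot_D(u) := (1/(2Δx)) · Σ_{k=1}^{4} (u(p_k) + u(p_{k+1})) · T_k equals 4α₀ = σ₀/(π(Δx/√2)²) = 2σ₀/(πΔx²). -/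
/-- Staggered (node-based) trapezoidal discrete rotational of the point-vortex
field on the central square cell equals `4α₀ = σ₀/(π(Δx/√2)²) = 2σ₀/(πΔx²)`. -/
theorem staggered_discrete_rot_point_vortex
    (Δx σ₀ α₀ : ℝ) (hΔx : 0 < Δx) (hα : α₀ = σ₀ / (2 * Real.pi * Δx ^ 2))
    (u : ℝ × ℝ → ℝ × ℝ)
    (hu : ∀ q : ℝ × ℝ, q ≠ 0 →
      u q = (σ₀ / (2 * Real.pi * (q.1 ^ 2 + q.2 ^ 2)) * (-q.2),
             σ₀ / (2 * Real.pi * (q.1 ^ 2 + q.2 ^ 2)) * q.1))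
    (p : Fin 4 → ℝ × ℝ)
    (hp0 : p 0 = (Δx / 2, Δx / 2)) (hp1 : p 1 = (-(Δx / 2), Δx / 2))
    (hp2 : p 2 = (-(Δx / 2), -(Δx / 2))) (hp3 : p 3 = (Δx / 2, -(Δx / 2)))
    (T : Fin 4 → ℝ × ℝ) (hT : ∀ k, T k = (1 / Δx) • (p (k + 1) - p k)) :
    (1 / (2 * Δx)) * ∑ k : Fin 4,
        ((u (p k) + u (p (k + 1))).1 * (T k).1
          + (u (p k) + u (p (k + 1))).2 * (T k).2) = 4 * α₀ ∧
    4 * α₀ = σ₀ / (Real.pi * (Δx / Real.sqrt 2) ^ 2) ∧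
    4 * α₀ = 2 * σ₀ / (Real.pi * Δx ^ 2) := by
  have ne0 : Δx ≠ 0 := hΔx.ne'
  have hs : (Δx / 2) ^ 2 + (Δx / 2) ^ 2 = Δx ^ 2 / 2 := by ring
  have node (k : Fin 4) (a b : ℝ) (hk : p k = (a, b)) (ha : a ≠ 0)
      (hab : a ^ 2 + b ^ 2 = Δx ^ 2 / 2) :
      u (p k) = (2 * α₀ * (-b), 2 * α₀ * a) := by
    have hne : p k ≠ 0 := fun h => ha (by simpa [hk] using congrArg Prod.fst h)
    rw [hu _ hne, hk, hα]
    simp only [hab, Prod.mk.injEq]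
    constructor <;> field_simp
  have h0 := node 0 _ _ hp0 (by positivity) hs
  have h1 := node 1 _ _ hp1 (neg_ne_zero.mpr (by positivity)) (by rw [neg_sq, hs])
  have h2 := node 2 _ _ hp2 (neg_ne_zero.mpr (by positivity)) (by rw [neg_sq, hs])
  have h3 := node 3 _ _ hp3 (by positivity) (by rw [neg_sq, hs])
  refine ⟨?_, ?_, ?_⟩
  · have e1 : (0 : Fin 4) + 1 = 1 := rfl
    have e2 : (1 : Fin 4) + 1 = 2 := rfl
    have e3 : (2 : Fin 4) + 1 = 3 := rfl
    have e4 : (3 : Fin 4) + 1 = 0 := rfl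
    simp only [Fin.sum_univ_four, hT, e1, e2, e3, e4, h0, h1, h2, h3]
    simp only [hp0, hp1, hp2, hp3, Prod.mk_add_mk, Prod.mk_sub_mk, Prod.smul_mk, smul_eq_mul]
    field_simp
    ring
  · rw [hα, div_pow, Real.sq_sqrt zero_le_two]
    field_simp
    ring
  · rw [hα]
    field_simp
    ring
end

section
/- BBC (face-based) discrete rotational of the point vortex field on the central dual cell: let Δx > 0, σ₀ ∈ ℝ, α₀ = σ₀/(2πΔx²), and let u(x,y) = σ₀/(2π(x²+y²))·(−y,x). Let m₁ = (Δx/2, 0), m₂ = (0, Δx/2), m₃ = (−Δx/2, 0), m₄ = (0, −Δx/2) be the midpoints of the faces of the square cell of side Δx centred at the origin, with corresponding counterclockwise unit tangents T₁ = (0,1), T₂ = (−1,0), T₃ = (0,−1), T₄ = (1,0). Then the midpoint-rule discrete rotational rot_BBC(u) := (1/Δx) · Σ_{k=1}^{4} u(m_k) · T_k equals 8α₀ = 4σ₀/(πΔx²); in particular it is exactly twice the staggered trapezoidal discrete rotational 4α₀ computed from the node values at (±Δx/2, ±Δx/2). -/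
/-- BBC (face-based) midpoint-rule discrete rotational of the point-vortex
field on the central dual cell equals `8α₀ = 4σ₀/(πΔx²)`, which is exactly
twice the staggered trapezoidal discrete rotational computed from the node
values at `(±Δx/2, ±Δx/2)`. -/
theorem bbc_discrete_rot_point_vortex
    (Δx σ₀ α₀ : ℝ) (hΔx : 0 < Δx) (hα : α₀ = σ₀ / (2 * Real.pi * Δx ^ 2))
    (u : ℝ × ℝ → ℝ × ℝ)
    (hu : ∀ q : ℝ × ℝ, q ≠ 0 →
      u q = (σ₀ / (2 * Real.pi * (q.1 ^ 2 + q.2 ^ 2)) * (-q.2),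
             σ₀ / (2 * Real.pi * (q.1 ^ 2 + q.2 ^ 2)) * q.1))
    (m : Fin 4 → ℝ × ℝ)
    (hm0 : m 0 = (Δx / 2, 0)) (hm1 : m 1 = (0, Δx / 2))
    (hm2 : m 2 = (-(Δx / 2), 0)) (hm3 : m 3 = (0, -(Δx / 2)))
    (T : Fin 4 → ℝ × ℝ)
    (hT0 : T 0 = (0, 1)) (hT1 : T 1 = (-1, 0))
    (hT2 : T 2 = (0, -1)) (hT3 : T 3 = (1, 0))
    (p : Fin 4 → ℝ × ℝ)
    (hp0 : p 0 = (Δx / 2, Δx / 2)) (hp1 : p 1 = (-(Δx / 2), Δx / 2))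
    (hp2 : p 2 = (-(Δx / 2), -(Δx / 2))) (hp3 : p 3 = (Δx / 2, -(Δx / 2)))
    (Tp : Fin 4 → ℝ × ℝ) (hTp : ∀ k, Tp k = (1 / Δx) • (p (k + 1) - p k)) :
    (1 / Δx) * ∑ k : Fin 4, ((u (m k)).1 * (T k).1 + (u (m k)).2 * (T k).2)
      = 8 * α₀ ∧
    8 * α₀ = 4 * σ₀ / (Real.pi * Δx ^ 2) ∧
    (1 / Δx) * ∑ k : Fin 4, ((u (m k)).1 * (T k).1 + (u (m k)).2 * (T k).2)
      = 2 * ((1 / (2 * Δx)) * ∑ k : Fin 4,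
          ((u (p k) + u (p (k + 1))).1 * (Tp k).1
            + (u (p k) + u (p (k + 1))).2 * (Tp k).2)) := by
  have hΔ : Δx ≠ 0 := hΔx.ne'
  have hπ : Real.pi ≠ 0 := Real.pi_ne_zero
  have hum : ∀ k, u (m k) = (2 * σ₀ / (Real.pi * Δx ^ 2) * (-(m k).2),
      2 * σ₀ / (Real.pi * Δx ^ 2) * (m k).1) := by
    intro k
    have hsq : (m k).1 ^ 2 + (m k).2 ^ 2 = Δx ^ 2 / 4 := by
      fin_cases k <;> simp [hm0, hm1, hm2, hm3] <;> ring
    have hne : m k ≠ 0 := by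
      intro h
      rw [h] at hsq
      simp at hsq
      exact (by positivity : (0 : ℝ) < _).ne hsq
    rw [hu _ hne, hsq]
    ext <;> simp only <;> field_simp <;> ring
  have hup : ∀ k, u (p k) = (σ₀ / (Real.pi * Δx ^ 2) * (-(p k).2),
      σ₀ / (Real.pi * Δx ^ 2) * (p k).1) := by
    intro k
    have hsq : (p k).1 ^ 2 + (p k).2 ^ 2 = Δx ^ 2 / 2 := by
      fin_cases k <;> simp [hp0, hp1, hp2, hp3] <;> ring
    have hne : p k ≠ 0 := by
      intro h
      rw [h] at hsq
      simp at hsq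
      exact (by positivity : (0 : ℝ) < _).ne hsq
    rw [hu _ hne, hsq]
    ext <;> simp only <;> field_simp
  have hface : (1 / Δx) * ∑ k : Fin 4, ((u (m k)).1 * (T k).1 + (u (m k)).2 * (T k).2)
      = 4 * σ₀ / (Real.pi * Δx ^ 2) := by
    simp only [Fin.sum_univ_four, hum, hm0, hm1, hm2, hm3, hT0, hT1, hT2, hT3]
    field_simp
    ring
  have hnode : (1 / (2 * Δx)) * ∑ k : Fin 4,
      ((u (p k) + u (p (k + 1))).1 * (Tp k).1 + (u (p k) + u (p (k + 1))).2 * (Tp k).2)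
      = 2 * σ₀ / (Real.pi * Δx ^ 2) := by
    have h01 : (0 : Fin 4) + 1 = 1 := rfl
    have h12 : (1 : Fin 4) + 1 = 2 := rfl
    have h23 : (2 : Fin 4) + 1 = 3 := rfl
    have h30 : (3 : Fin 4) + 1 = 0 := rfl
    simp only [Fin.sum_univ_four, hTp, hup, h01, h12, h23, h30, hp0, hp1, hp2, hp3,
      Prod.fst_add, Prod.snd_add, Prod.smul_fst, Prod.smul_snd, Prod.fst_sub, Prod.snd_sub,
      smul_eq_mul]
    field_simp
    ring
  have hα₀ : 8 * α₀ = 4 * σ₀ / (Real.pi * Δx ^ 2) := by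
    rw [hα]
    field_simp
    ring
  refine ⟨hface.trans hα₀.symm, hα₀, ?_⟩
  rw [hface, hnode]
  ring
end

section
/- Radial velocity perturbations at the nodes do not affect the staggered trapezoidal discrete rotational on a square centred at the origin: let Δx > 0, let p₁ = (Δx/2, Δx/2), p₂ = (−Δx/2, Δx/2), p₃ = (−Δx/2, −Δx/2), p₄ = (Δx/2, −Δx/2) (counterclockwise, indices mod 4) with unit tangents T_k = (p_{k+1} − p_k)/Δx, let v₁, v₂, v₃, v₄ ∈ ℝ² be arbitrary node velocities and β₁, β₂, β₃, β₄ ∈ ℝ arbitrary coefficients. Then (1/(2Δx)) Σ_{k=1}^{4} ((v_k + β_k p_k) + (v_{k+1} + β_{k+1} p_{k+1})) · T_k = (1/(2Δx)) Σ_{k=1}^{4} (v_k + v_{k+1}) · T_k. In particular, since the staggered scheme's projected velocities at the nodes of the central cell differ from the initial point-vortex velocities only by radial components, the discrete rotational of the point vortex is exactly conserved by the staggered scheme: rot_D(u^{n+1})/rot_D(u^n) = 1. -/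
/-- Radial velocity perturbations at the nodes do not affect the staggered
trapezoidal discrete rotational on a square centred at the origin: adding to
each node velocity `v_k` a radial component `β_k • p_k` leaves the discrete
rotational unchanged. -/
theorem staggered_discrete_rot_radial_invariance
    (Δx : ℝ) (hΔx : 0 < Δx)
    (p : Fin 4 → ℝ × ℝ)
    (hp0 : p 0 = (Δx / 2, Δx / 2)) (hp1 : p 1 = (-(Δx / 2), Δx / 2))
    (hp2 : p 2 = (-(Δx / 2), -(Δx / 2))) (hp3 : p 3 = (Δx / 2, -(Δx / 2)))
    (T : Fin 4 → ℝ × ℝ) (hT : ∀ k, T k = (1 / Δx) • (p (k + 1) - p k))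
    (v : Fin 4 → ℝ × ℝ) (β : Fin 4 → ℝ) :
    (1 / (2 * Δx)) * ∑ k : Fin 4,
        (((v k + β k • p k) + (v (k + 1) + β (k + 1) • p (k + 1))).1 * (T k).1
          + ((v k + β k • p k) + (v (k + 1) + β (k + 1) • p (k + 1))).2 * (T k).2)
      = (1 / (2 * Δx)) * ∑ k : Fin 4,
          ((v k + v (k + 1)).1 * (T k).1 + (v k + v (k + 1)).2 * (T k).2) := by
  have h30 : (3 : Fin 4) + 1 = 0 := rfl
  have h12 : (1 : Fin 4) + 1 = 2 := rfl
  have h23 : (2 : Fin 4) + 1 = 3 := rfl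
  simp only [Fin.sum_univ_four, hT, zero_add, h12, h23, h30, hp0, hp1, hp2, hp3,
    Prod.fst_add, Prod.snd_add, Prod.smul_fst, Prod.smul_snd, Prod.fst_sub, Prod.snd_sub,
    smul_eq_mul]
  ring
end
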